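/- Let a₋ < 0 < a₊, σ₋ < 0 < σ₊, and c₋, c₊ > 0 be real constants, and set k₋ := √(c₋/(−σ₋)), k₊ := √(c₊/σ₊). For each integer j ≥ 1 let τ_j denote the unique solution in the interval ( jπ/(k₊ a₊), (2j+1)π/(2 k₊ a₊) ) of σ₋ k₋ tan(τ k₊ a₊) = σ₊ k₊ tanh(τ k₋ a₋). Then sin²(τ_j k₊ a₊) converges to σ₊ c₊ / ( σ₊ c₊ + (−σ₋) c₋ ) as j → ∞. -/

import Mathlib

open Real Filter Topology

/-- The hyperbolic tangent tends to `-1` at `-∞`. -/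
theorem tendsto_tanh_atBot : Tendsto Real.tanh atBot (𝓝 (-1)) := by
  have hexp : Tendsto (fun x : ℝ => Real.exp (2 * x)) atBot (𝓝 0) :=
    Real.tendsto_exp_atBot.comp (tendsto_id.const_mul_atBot two_pos)
  have h : Tendsto (fun x : ℝ => (Real.exp (2 * x) - 1) / (Real.exp (2 * x) + 1)) atBot
      (𝓝 ((0 - 1) / (0 + 1))) :=
    (hexp.sub_const 1).div (hexp.add_const 1) (by norm_num)
  convert h using 1
  · funext x
    have hx := Real.exp_pos x
    rw [Real.tanh_eq, Real.exp_neg, two_mul, Real.exp_add]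
    field_simp
  · norm_num

/-- If `a tan θ = b t` with `a ≠ 0` and `b t ≠ 0`, then `sin² θ` is determined by `a`, `b`, `t`. -/
theorem sin_sq_eq_of_mul_tan_eq {a b t θ : ℝ} (ha : a ≠ 0) (hbt : b * t ≠ 0)
    (h : a * Real.tan θ = b * t) :
    Real.sin θ ^ 2 = b ^ 2 * t ^ 2 / (a ^ 2 + b ^ 2 * t ^ 2) := by
  have hcos : Real.cos θ ≠ 0 := by
    intro hc
    rw [Real.tan_eq_sin_div_cos, hc, div_zero, mul_zero] at h
    exact hbt h.symm
  have hpos : 0 < a ^ 2 + b ^ 2 * t ^ 2 := by positivity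
  have hsin : a * Real.sin θ = b * t * Real.cos θ := by
    rw [← h, mul_assoc, Real.tan_mul_cos hcos]
  rw [eq_div_iff hpos.ne']
  linear_combination (a * Real.sin θ + b * t * Real.cos θ) * hsin +
    b ^ 2 * t ^ 2 * Real.sin_sq_add_cos_sq θ

/-- eq. 5.8, first limit: the solutions `τ_j` of
`σ₋ k₋ tan(τ k₊ a₊) = σ₊ k₊ tanh(τ k₋ a₋)` in `(jπ/(k₊a₊), (2j+1)π/(2k₊a₊))` satisfy
`sin²(τ_j k₊ a₊) → σ₊c₊/(σ₊c₊ + (-σ₋)c₋)` as `j → ∞`. -/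
theorem stmt_16 (am ap σm σp cm cp km kp : ℝ)
    (ham : am < 0) (hap : 0 < ap) (hσm : σm < 0) (hσp : 0 < σp)
    (hcm : 0 < cm) (hcp : 0 < cp)
    (hkm : km = Real.sqrt (cm / (-σm))) (hkp : kp = Real.sqrt (cp / σp))
    (τ : ℕ → ℝ)
    (hτ : ∀ j : ℕ, 1 ≤ j →
      τ j ∈ Set.Ioo ((j * π) / (kp * ap)) (((2 * j + 1) * π) / (2 * kp * ap)) ∧
      σm * km * Real.tan (τ j * kp * ap) = σp * kp * Real.tanh (τ j * km * am)) :
    Tendsto (fun j : ℕ => Real.sin (τ j * kp * ap) ^ 2) atTop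
      (𝓝 (σp * cp / (σp * cp + (-σm) * cm))) := by
  have hkm_pos : 0 < km := hkm ▸ Real.sqrt_pos.2 (div_pos hcm (neg_pos.2 hσm))
  have hkp_pos : 0 < kp := hkp ▸ Real.sqrt_pos.2 (div_pos hcp hσp)
  have hA : (σm * km) ^ 2 = -σm * cm := by
    rw [mul_pow, hkm, Real.sq_sqrt (div_pos hcm (neg_pos.2 hσm)).le]
    field_simp
  have hB : (σp * kp) ^ 2 = σp * cp := by
    rw [mul_pow, hkp, Real.sq_sqrt (div_pos hcp hσp).le]
    field_simp
  have hA_pos : 0 < -σm * cm := mul_pos (neg_pos.2 hσm) hcm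
  have hB_pos : 0 < σp * cp := mul_pos hσp hcp
  have hτ_lim : Tendsto τ atTop atTop := by
    have h : Tendsto (fun j : ℕ => ((j : ℝ) * π) / (kp * ap)) atTop atTop :=
      (tendsto_natCast_atTop_atTop.atTop_mul_const Real.pi_pos).atTop_div_const
        (mul_pos hkp_pos hap)
    refine tendsto_atTop_mono' _ ?_ h
    filter_upwards [eventually_ge_atTop 1] with j hj
    exact (hτ j hj).1.1.le
  have htanh : Tendsto (fun j : ℕ => Real.tanh (τ j * km * am)) atTop (𝓝 (-1)) :=
    tendsto_tanh_atBot.comp ((hτ_lim.atTop_mul_const hkm_pos).atTop_mul_const_of_neg ham)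
  have hnum : Tendsto (fun j : ℕ => σp * cp * Real.tanh (τ j * km * am) ^ 2) atTop
      (𝓝 (σp * cp)) := by
    simpa using (htanh.pow 2).const_mul (σp * cp)
  have hquot := hnum.div (hnum.add_const (-σm * cm)) (add_pos hB_pos hA_pos).ne'
  refine hquot.congr' ?_
  filter_upwards [eventually_ge_atTop 1, htanh.eventually_ne (by norm_num : (-1 : ℝ) ≠ 0)]
    with j hj ht
  rw [sin_sq_eq_of_mul_tan_eq (mul_ne_zero hσm.ne hkm_pos.ne')
    (mul_ne_zero (mul_pos hσp hkp_pos).ne' ht) (hτ j hj).2, hA, hB]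
  simp only [Pi.div_apply]
  rw [add_comm]
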